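/- The left ideal I = LH of the semigroup H is infinite: there exist infinitely many pairwise distinct nonzero elements of H of the form L·A with A a word in a1, a2, a3. -/

import Mathlib

inductive Phi
  | L | M | P | Q | R | g | s1 | s2 | t1 | t2 | t3 | a1 | a2 | a3
deriving DecidableEq

open Phi

abbrev W0 := WithZero (FreeMonoid Phi)

def w (l : List Phi) : W0 := ((FreeMonoid.ofList l : FreeMonoid Phi) : W0)

def ai : Fin 3 → Phi
  | 0 => a1 | 1 => a2 | 2 => a3

def ti : Fin 3 → Phi
  | 0 => t1 | 1 => t2 | 2 => t3

def si : Fin 2 → Phi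
  | 0 => s1 | 1 => s2

/-- `x` is one of the letters `a1, a2, a3`. -/
def isA (x : Phi) : Prop := x = a1 ∨ x = a2 ∨ x = a3

/-- The defining relations (1)–(14) of the semigroup `H`. -/
inductive rel : W0 → W0 → Prop
  | r1L (x : Phi) : rel (w [x, L]) 0
  | r1M (x : Phi) : rel (w [x, M]) 0
  | r2 : rel (w [L]) (w [M, P, g])
  | r3 (i : Fin 3) : rel (w [g, ai i]) (w [ai i, g])
  | r4 (x : Phi) (h : ¬ isA x) : rel (w [g, x]) 0
  | r5 (i j : Fin 3) : rel (w [ai i, g, ai j]) (w [ai i, R, s1, Q, ai j])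
  | r6 (i : Fin 3) (x : Phi) (h : x = R ∨ isA x) : rel (w [ti i, x]) (w [x, ti i])
  | r7 (i : Fin 3) : rel (w [P, ai i, ti i]) (w [ai i, P, s1])
  | r8 (i j : Fin 3) (h : i ≠ j) : rel (w [P, ai j, ti i]) (w [ai j, P, s2])
  | r9 (i : Fin 3) (j : Fin 2) : rel (w [si j, ai i]) (w [ai i, si j])
  | r10 : rel (w [s1, R]) (w [R, s1])
  | r11 (i : Fin 3) : rel (w [s1, Q, ai i]) (w [ti i, ai i, Q])
  | r12 : rel (w [P, R, s1]) 0
  | r13 (i : Fin 3) : rel (w [s2, R, ai i]) (w [ai i, s2, R])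
  | r14 (i : Fin 3) : rel (w [s2, R, Q, ai i]) (w [R, ti i, ai i, Q])

/-- The congruence on the free monoid with zero generated by the relations. -/
def hCon : Con W0 := conGen rel

/-- The semigroup (with zero) `H` of the paper. -/
abbrev H := hCon.Quotient

/-- The quotient map. -/
def q : W0 →* H := hCon.mk'

/-- `l` is a word in the letters `a1, a2, a3`. -/
def Aword (l : List Phi) : Prop := ∀ x ∈ l, isA x

/-- `l` is square-free: it contains no factor `Y ++ Y` with `Y` nonempty. -/
def SqFree (l : List Phi) : Prop := ∀ Y : List Phi, Y ≠ [] → ¬ (Y ++ Y) <:+: l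

/-! ### Square-free ternary words -/

/-- The Thue–Morse sequence. -/
def thueMorse : ℕ → Bool
  | 0 => false
  | n + 1 => xor (thueMorse ((n + 1) / 2)) (decide ((n + 1) % 2 = 1))

theorem thueMorse_two_mul (n : ℕ) : thueMorse (2 * n) = thueMorse n := by
  rcases n with _ | n
  · rfl
  · rw [show 2 * (n + 1) = (2 * n + 1) + 1 by ring, thueMorse,
      show (2 * n + 1 + 1) / 2 = n + 1 by omega, show (2 * n + 1 + 1) % 2 = 0 by omega]
    simp

theorem thueMorse_two_mul_add_one (n : ℕ) : thueMorse (2 * n + 1) = !thueMorse n := by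
  rw [thueMorse, show (2 * n + 1) / 2 = n by omega, show (2 * n + 1) % 2 = 1 by omega]
  simp

theorem thueMorse_no_odd_overlap (n p : ℕ) (hp : p % 2 = 1)
    (h : ∀ i ≤ p, thueMorse (n + i) = thueMorse (n + i + p)) : False := by
  have hne (m : ℕ) (hm : m % 2 = 0) : thueMorse (m + 1) = !thueMorse m := by
    obtain ⟨k, rfl⟩ : ∃ k, m = 2 * k := ⟨m / 2, by omega⟩
    rw [thueMorse_two_mul_add_one, thueMorse_two_mul]
  have hstep (i : ℕ) (hi : i < p) : thueMorse (n + p + (i + 1)) = !thueMorse (n + p + i) := by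
    rcases Nat.mod_two_eq_zero_or_one (n + p + i) with h0 | h1
    · exact hne _ h0
    · have h2 := hne (n + i) (by omega)
      have h3 := h i hi.le
      have h4 := h (i + 1) hi
      rw [show n + p + (i + 1) = n + (i + 1) + p by ring, show n + p + i = n + i + p by ring,
        ← h3, ← h4, ← h2, add_assoc]
  have halt (i : ℕ) (hi : i ≤ p) :
      thueMorse (n + p + i) = xor (thueMorse (n + p)) (decide (i % 2 = 1)) := by
    induction i with
    | zero => simp
    | succ i ih =>
      rw [hstep i hi, ih (by omega)]
      rcases Nat.mod_two_eq_zero_or_one i with h0 | h1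
      · simp [h0, show (i + 1) % 2 = 1 by omega]
      · simp [h1, show (i + 1) % 2 = 0 by omega]
  have := halt p le_rfl
  rw [← h p le_rfl, hp] at this
  simp at this

/-- The Thue–Morse sequence is overlap-free. -/
theorem thueMorse_no_overlap (p : ℕ) : ∀ n, 0 < p →
    ¬ ∀ i ≤ p, thueMorse (n + i) = thueMorse (n + i + p) := by
  induction p using Nat.strong_induction_on with
  | _ p ih =>
    intro n hp h
    rcases Nat.mod_two_eq_zero_or_one p with h0 | h1
    · obtain ⟨r, rfl⟩ : ∃ r, p = 2 * r := ⟨p / 2, by omega⟩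
      refine ih r (by omega) (n / 2) (by omega) fun i hi => ?_
      have hs := h (2 * i) (by omega)
      rcases Nat.mod_two_eq_zero_or_one n with hn | hn
      · rw [show n + 2 * i + 2 * r = 2 * (n / 2 + i + r) by omega,
          show n + 2 * i = 2 * (n / 2 + i) by omega] at hs
        simpa only [thueMorse_two_mul] using hs
      · rw [show n + 2 * i + 2 * r = 2 * (n / 2 + i + r) + 1 by omega,
          show n + 2 * i = 2 * (n / 2 + i) + 1 by omega] at hs
        simpa only [thueMorse_two_mul_add_one, Bool.not_inj_iff] using hs
    · exact thueMorse_no_odd_overlap n p h1 h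

/-- The consecutive differences of the Thue–Morse sequence. -/
def ternaryThue (n : ℕ) : Fin 3 :=
  match thueMorse n, thueMorse (n + 1) with
  | false, true => 1
  | true, false => 2
  | _, _ => 0

theorem ternaryThue_squareFree (n p : ℕ) (hp : 0 < p) :
    ¬ ∀ i < p, ternaryThue (n + i) = ternaryThue (n + p + i) := by
  intro h
  by_cases h0 : thueMorse n = thueMorse (n + p)
  · refine thueMorse_no_overlap p n hp fun i hi => ?_
    rw [add_right_comm]
    induction i with
    | zero => exact h0
    | succ i ih =>
      have h1 := h i hi
      have h2 := ih (by omega)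
      simp only [← add_assoc]
      unfold ternaryThue at h1
      revert h1 h2
      generalize thueMorse (n + i) = a
      generalize thueMorse (n + i + 1) = b
      generalize thueMorse (n + p + i) = c
      generalize thueMorse (n + p + i + 1) = d
      revert a b c d
      decide
  · have hconst (i : ℕ) (hi : i ≤ p) :
        thueMorse (n + i) = thueMorse n ∧ thueMorse (n + p + i) = thueMorse (n + p) := by
      induction i with
      | zero => exact ⟨rfl, rfl⟩
      | succ i ih =>
        have h1 := h i hi
        have h2 := ih (by omega)
        simp only [← add_assoc]
        unfold ternaryThue at h1
        revert h0 h1 h2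
        generalize thueMorse (n + i) = a
        generalize thueMorse (n + i + 1) = b
        generalize thueMorse (n + p + i) = c
        generalize thueMorse (n + p + i + 1) = d
        generalize thueMorse n = e
        generalize thueMorse (n + p) = f
        revert a b c d e f
        decide
    exact h0 (hconst p le_rfl).1.symm

/-- The list `l` has no factor `Y ++ Y` with `Y` nonempty. -/
def ListSquareFree {α : Type*} (l : List α) : Prop :=
  ∀ Y : List α, Y ≠ [] → ¬ (Y ++ Y) <:+: l

theorem listSquareFree_map_ternaryThue (N : ℕ) :
    ListSquareFree ((List.range N).map ternaryThue) := by
  rintro Y hY ⟨u, v, h⟩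
  have hlen := congrArg List.length h
  simp only [List.length_append, List.length_map, List.length_range] at hlen
  refine ternaryThue_squareFree u.length Y.length (List.length_pos_iff.2 hY) fun i hi => ?_
  have get (k : ℕ) (hk : k < N) :
      (u ++ (Y ++ Y) ++ v)[k]? = some (ternaryThue k) := by
    rw [h]; simp [hk]
  have h1 := get (u.length + i) (by omega)
  have h2 := get (u.length + Y.length + i) (by omega)
  have e1 : (u ++ (Y ++ Y) ++ v)[u.length + i]? = Y[i]? := by
    simp [List.getElem?_append_right, List.getElem?_append_left, hi]
  have e2 : (u ++ (Y ++ Y) ++ v)[u.length + Y.length + i]? = Y[i]? := by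
    simp [List.getElem?_append_right, List.getElem?_append_left, hi, add_assoc]
  rw [e1] at h1
  rw [e2] at h2
  exact Option.some.inj (h1.symm.trans h2)

/-! ### An automaton recognizing the class of `L·A` -/

/-- The letters that travel between the markers `P` and `Q`. -/
inductive Signal
  | s1 | s2 | t (i : Fin 3)

/-- States of an automaton reading words from left to right. A word of the form
`M U P X R Y Q W` carrying one signal is remembered by the words `U`, `X`, `Y`, `W` in
`a1, a2, a3`, and by the signal but not by its position. When the signal is `s2`, only the
concatenation of `X` and `Y` is remembered. A word `L Z` or `M U P X g W` is remembered
by the projection to the letters `a1, a2, a3`. -/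
inductive Scan
  | dead
  | start
  | withG (Z : List (Fin 3))
  | atM (U : List (Fin 3))
  | atP (c : Option Signal) (U X : List (Fin 3))
  | atR (c : Option Signal) (U X Y : List (Fin 3))
  | atRMismatch (U X : List (Fin 3))
  | atQ (c : Signal) (U X Y W : List (Fin 3))
  | atQMismatch (U X W : List (Fin 3))

namespace Scan

/-- Read the letter `ai i`. -/
def push (i : Fin 3) : Scan → Scan
  | withG Z => withG (Z ++ [i])
  | atM U => atM (U ++ [i])
  | atP c U X => atP c U (X ++ [i])
  | atR c U X Y => atR c U X (Y ++ [i])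
  | atRMismatch U X => atRMismatch U (X ++ [i])
  | atQ c U X Y W => atQ c U X Y (W ++ [i])
  | atQMismatch U X W => atQMismatch U X (W ++ [i])
  | dead => dead
  | start => dead

/-- Read a signal. -/
def emit : Signal → Scan → Scan
  | c, atP none U X => atP (some c) U X
  | .s1, atR none U X Y => atR (some .s1) U X Y
  | .t i, atR none U X Y => atR (some (.t i)) U X Y
  | _, _ => dead

/-- Read the letter `R`. -/
def readR : Scan → Scan
  | atP none U X => atR none U X []
  | atP (some .s1) U X => atR (some .s1) U X []
  | atP (some (.t i)) U X => atR (some (.t i)) U X []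
  | atP (some .s2) U X => atRMismatch U X
  | _ => dead

/-- Read the letter `Q`. -/
def readQ : Scan → Scan
  | atR (some c) U X Y => atQ c U X Y []
  | atRMismatch U X => atQMismatch U X []
  | _ => dead

/-- Read the letter `P`. -/
def readP : Scan → Scan
  | atM U => atP none U []
  | _ => dead

/-- Read the letter `g`. -/
def readG : Scan → Scan
  | atP none U X => withG (U ++ X)
  | _ => dead

/-- Read the letter `L`. -/
def readL : Scan → Scan
  | start => withG []
  | _ => dead

/-- Read the letter `M`. -/
def readM : Scan → Scan
  | start => atM []
  | _ => dead

/-- The transition function. -/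
def step (σ : Scan) : Phi → Scan
  | .L => σ.readL
  | .M => σ.readM
  | .P => σ.readP
  | .Q => σ.readQ
  | .R => σ.readR
  | .g => σ.readG
  | .s1 => σ.emit .s1
  | .s2 => σ.emit .s2
  | .t1 => σ.emit (.t 0)
  | .t2 => σ.emit (.t 1)
  | .t3 => σ.emit (.t 2)
  | .a1 => σ.push 0
  | .a2 => σ.push 1
  | .a3 => σ.push 2

/-- The accepting states: those reached by the words equal to `L·A` in `H`. -/
def Accepting (A : List (Fin 3)) : Scan → Prop
  | withG Z => Z = A
  | atQ .s1 U X Y W => U ++ X ++ Y ++ W = A ∧ ¬ X <+: W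
  | atQ (.t i) U (k :: X) Y W =>
      U ++ k :: X ++ Y ++ W = A ∧ (k = i → ¬ X <+: W) ∧ (k ≠ i → X ++ Y ≠ [])
  | atQMismatch U X W => U ++ X ++ W = A ∧ X ≠ []
  | _ => False

theorem step_ai (σ : Scan) (i : Fin 3) : σ.step (ai i) = σ.push i := by
  fin_cases i <;> rfl

theorem step_ti (σ : Scan) (i : Fin 3) : σ.step (ti i) = σ.emit (.t i) := by
  fin_cases i <;> rfl

/-- A bisimulation between states that contains the defining relations of `H`. -/
inductive Bisim : Scan → Scan → Prop
  | refl (σ) : Bisim σ σ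
  | deadR (U Y) : Bisim (atR (some .s1) U [] Y) dead
  | deadQ (U Y W) : Bisim (atQ .s1 U [] Y W) dead
  | withG (U X W) (hX : X ≠ []) (hW : W ≠ []) : Bisim (withG (U ++ X ++ W)) (atQ .s1 U X [] W)
  | matchP (i U X) : Bisim (atP (some (.t i)) U (i :: X)) (atP (some .s1) (U ++ [i]) X)
  | matchR (i U X Y) : Bisim (atR (some (.t i)) U (i :: X) Y) (atR (some .s1) (U ++ [i]) X Y)
  | matchQ (i U X Y W) : Bisim (atQ (.t i) U (i :: X) Y W) (atQ .s1 (U ++ [i]) X Y W)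
  | mismatchP (i j U X) (h : i ≠ j) :
      Bisim (atP (some (.t i)) U (j :: X)) (atP (some .s2) (U ++ [j]) X)
  | mismatchR (i j U X Y) (h : i ≠ j) :
      Bisim (atR (some (.t i)) U (j :: X) Y) (atRMismatch (U ++ [j]) (X ++ Y))
  | mismatchQ (i j U X Y W) (h : i ≠ j) :
      Bisim (atQ (.t i) U (j :: X) Y W) (atQMismatch (U ++ [j]) (X ++ Y) W)
  | advance (i U X Y W) : Bisim (atQ .s1 U X Y (i :: W)) (atQ (.t i) U X (Y ++ [i]) W)
  | restart (i U X W) : Bisim (atQMismatch U X (i :: W)) (atQ (.t i) U X [i] W)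

theorem Bisim.push {σ τ : Scan} (h : Bisim σ τ) (i : Fin 3) : Bisim (σ.push i) (τ.push i) := by
  cases h with
  | withG U X W hX hW =>
    simpa [Scan.push] using Bisim.withG U X (W ++ [i]) hX (by simp)
  | mismatchR k j U X Y h =>
    simpa [Scan.push] using Bisim.mismatchR k j U X (Y ++ [i]) h
  | _ => constructor <;> assumption

theorem Bisim.step {σ τ : Scan} (h : Bisim σ τ) (x : Phi) : Bisim (σ.step x) (τ.step x) := by
  have ha := h.push
  cases x
  case a1 | a2 | a3 => exact ha _
  case R =>
    cases h
    case mismatchP i j U X h => simpa [Scan.step, readR] using Bisim.mismatchR i j U X [] h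
    all_goals constructor
  all_goals cases h <;> constructor <;> assumption

theorem Bisim.foldl {σ τ : Scan} (h : Bisim σ τ) (l : List Phi) :
    Bisim (l.foldl Scan.step σ) (l.foldl Scan.step τ) := by
  induction l generalizing σ τ with
  | nil => exact h
  | cons x l ih => exact ih (h.step x)

theorem Bisim.accepting_iff {A : List (Fin 3)} (hA : ListSquareFree A) {σ τ : Scan}
    (h : Bisim σ τ) : σ.Accepting A ↔ τ.Accepting A := by
  have key (U X Z : List (Fin 3)) (hX : X ≠ []) (hU : U ++ (X ++ Z) = A) : ¬ X <+: Z := by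
    rintro ⟨V, rfl⟩
    exact hA X hX ⟨U, V, by simpa using hU⟩
  cases h with
  | refl => rfl
  | deadR => rfl
  | deadQ => simp [Accepting]
  | withG U X W hX hW =>
    simp only [Accepting, List.append_nil, List.append_assoc]
    exact ⟨fun h => ⟨h, key U X W hX h⟩, fun h => h.1⟩
  | matchP | matchR | mismatchP | mismatchR => rfl
  | matchQ => simp [Accepting]
  | mismatchQ i j U X Y W h => simp [Accepting, h.symm]
  | advance i U X Y W =>
    cases X with
    | nil => simp [Accepting]
    | cons k X =>
      by_cases hk : k = i <;> simp [Accepting, hk, List.cons_prefix_cons]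
  | restart i U X W =>
    cases X with
    | nil => simp [Accepting]
    | cons k X =>
      by_cases hk : k = i
      · subst hk
        simp only [Accepting, ne_eq, reduceCtorEq, not_false_eq_true, and_true, forall_const,
          not_true_eq_false, false_implies, List.append_assoc, List.cons_append, List.nil_append]
        refine ⟨fun h => ⟨h, fun hp => ?_⟩, fun h => h.1⟩
        exact key U (k :: X) (k :: W) (by simp) (by simpa using h)
          (List.cons_prefix_cons.2 ⟨rfl, hp⟩)
      · simp [Accepting, hk]

end Scan

/-! ### The congruence -/

theorem w_append (l m : List Phi) : w (l ++ m) = w l * w m := rfl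

theorem w_injective : Function.Injective w := fun l m h => by
  simpa [w] using h

theorem w_ne_zero (l : List Phi) : w l ≠ 0 := WithZero.coe_ne_zero

theorem eq_zero_or_eq_w (x : W0) : x = 0 ∨ ∃ l, x = w l := by
  induction x using WithZero.recZeroCoe with
  | zero => exact Or.inl rfl
  | coe l => exact Or.inr ⟨l.toList, rfl⟩

/-- The defining relations lead to bisimilar states. -/
theorem rel.bisim {x y : W0} (h : rel x y) : ∃ l, x = w l ∧
    ((y = 0 ∧ ∀ σ : Scan, (l.foldl Scan.step σ).Bisim .dead) ∨
      ∃ m, y = w m ∧ ∀ σ : Scan, (l.foldl Scan.step σ).Bisim (m.foldl Scan.step σ)) := by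
  cases h <;> refine ⟨_, rfl, ?_⟩
  case r1L x | r1M x =>
    refine Or.inl ⟨rfl, fun σ => ?_⟩
    cases x <;> rcases σ with _ | _ | _ | _ | ⟨_ | _ | _ | _⟩ | ⟨_ | _ | _ | _⟩ | _ | _ | _ <;>
      exact .refl _
  case r4 x hx =>
    refine Or.inl ⟨rfl, fun σ => ?_⟩
    cases x
    case a1 | a2 | a3 => simp [isA] at hx
    all_goals
      rcases σ with _ | _ | _ | _ | ⟨_ | _ | _ | _⟩ | _ | _ | _ | _ <;> exact .refl _
  case r12 =>
    refine Or.inl ⟨rfl, fun σ => ?_⟩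
    cases σ <;> constructor
  all_goals refine Or.inr ⟨_, rfl, fun σ => ?_⟩
  case r6 i x hx =>
    rcases hx with rfl | rfl | rfl | rfl <;>
    rcases σ with _ | _ | _ | _ | ⟨_ | _ | _ | _⟩ | ⟨_ | _ | _ | _⟩ | _ | _ | _ <;>
    simp only [List.foldl, Scan.step_ti] <;> exact .refl _
  case r9 i j =>
    fin_cases j <;>
    rcases σ with _ | _ | _ | _ | ⟨_ | _ | _ | _⟩ | ⟨_ | _ | _ | _⟩ | _ | _ | _ <;>
    simp only [List.foldl, Scan.step_ai] <;> exact .refl _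
  all_goals
    simp only [List.foldl, Scan.step_ai, Scan.step_ti]
    rcases σ with _ | _ | _ | _ | ⟨_ | _ | _ | _, U, X⟩ | ⟨_ | _ | _ | _, U, X, Y⟩ | _ | _ | _
    all_goals try exact .refl _
  case r3.atP.none i => simpa [Scan.step, Scan.readG, Scan.push] using Scan.Bisim.refl _
  case r5.atP.none i j =>
    simpa [Scan.step, Scan.readG, Scan.readR, Scan.readQ, Scan.emit, Scan.push] using
      Scan.Bisim.withG U (X ++ [i]) [j] (by simp) (by simp)
  case r7.atM i U => exact .matchP i U []
  case r8.atM i j h U => exact .mismatchP i j U [] h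
  case r11.atR.none i => exact .advance i U X Y []
  case r14.atP.none i => exact .restart i U X []

/-- `x` is a word accepted by the automaton. -/
def Recognized (A : List (Fin 3)) (x : W0) : Prop :=
  ∃ l, x = w l ∧ (l.foldl Scan.step .start).Accepting A

theorem recognized_w {A : List (Fin 3)} {l : List Phi} :
    Recognized A (w l) ↔ (l.foldl Scan.step .start).Accepting A :=
  ⟨fun ⟨_, h, h'⟩ => w_injective h ▸ h', fun h => ⟨l, rfl, h⟩⟩

theorem not_recognized_zero {A : List (Fin 3)} : ¬ Recognized A 0 :=
  fun ⟨l, h, _⟩ => w_ne_zero l h.symm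

/-- The syntactic congruence of the set of recognized words. -/
def syntacticCon (A : List (Fin 3)) : Con W0 where
  r x y := ∀ u v, Recognized A (u * x * v) ↔ Recognized A (u * y * v)
  iseqv := ⟨fun _ _ _ => Iff.rfl, fun h u v => (h u v).symm, fun h h' u v => (h u v).trans (h' u v)⟩
  mul' {a b c d} h h' u v := by
    have h1 := h u (c * v)
    have h2 := h' (u * b) v
    simp only [mul_assoc] at h1 h2 ⊢
    exact h1.trans h2

theorem foldl_step_dead (l : List Phi) : l.foldl Scan.step .dead = .dead := by
  induction l with
  | nil => rfl
  | cons x l ih => cases x <;> exact ih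

theorem hCon_le_syntacticCon {A : List (Fin 3)} (hA : ListSquareFree A) :
    hCon ≤ syntacticCon A := by
  refine Con.conGen_le.2 fun x y h u v => ?_
  rcases eq_zero_or_eq_w u with rfl | ⟨u, rfl⟩
  · simp
  rcases eq_zero_or_eq_w v with rfl | ⟨v, rfl⟩
  · simp
  obtain ⟨l, rfl, ⟨rfl, hl⟩ | ⟨m, rfl, hl⟩⟩ := h.bisim
  · simp only [← w_append, recognized_w, List.foldl_append, mul_zero, zero_mul,
      not_recognized_zero, iff_false]
    rw [((hl _).foldl v).accepting_iff hA, foldl_step_dead]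
    exact id
  · simp only [← w_append, recognized_w, List.foldl_append]
    exact ((hl _).foldl v).accepting_iff hA

theorem recognized_iff_of_q_eq {A : List (Fin 3)} (hA : ListSquareFree A) {x y : W0}
    (h : q x = q y) : Recognized A x ↔ Recognized A y := by
  simpa using hCon_le_syntacticCon hA ((Con.eq _).1 h) 1 1

theorem recognized_L_map_ai {A B : List (Fin 3)} :
    Recognized A (w (Phi.L :: B.map ai)) ↔ B = A := by
  have (Z : List (Fin 3)) : (B.map ai).foldl Scan.step (.withG Z) = .withG (Z ++ B) := by
    induction B generalizing Z with
    | nil => simp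
    | cons i B ih => simp [Scan.step_ai, Scan.push, ih]
  rw [recognized_w, List.foldl_cons, show Scan.start.step .L = .withG [] from rfl, this]
  rfl

theorem isA_ai (i : Fin 3) : isA (ai i) := by
  fin_cases i <;> simp [isA, ai]

/-- the left ideal `LH` is infinite: there are infinitely many pairwise
distinct nonzero elements of `H` of the form `L·A` with `A` a word in `a1,a2,a3`. -/
theorem stmt13 :
    Set.Infinite {x : H | x ≠ q 0 ∧ ∃ A : List Phi, Aword A ∧ x = q (w (L :: A))} := by
  let B (N : ℕ) : List (Fin 3) := (List.range N).map ternaryThue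
  have hB (N : ℕ) : ListSquareFree (B N) := listSquareFree_map_ternaryThue N
  refine Set.infinite_of_injective_forall_mem (f := fun N => q (w (L :: (B N).map ai))) ?_ ?_
  · intro N N' h
    have := (recognized_iff_of_q_eq (hB N') h).2 (recognized_L_map_ai.2 rfl)
    simpa [B] using congrArg List.length (recognized_L_map_ai.1 this)
  · refine fun N => ⟨fun h => ?_, (B N).map ai, ?_, rfl⟩
    · exact not_recognized_zero ((recognized_iff_of_q_eq (hB N) h).1 (recognized_L_map_ai.2 rfl))
    · intro x hx
      obtain ⟨i, -, rfl⟩ := List.mem_map.1 hx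
      exact isA_ai i
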